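/- Special case of Carlitz's ${}_5\phi_4$ sum with even upper index: for any nonnegative integer m and parameters b, c, d, e with b·c·d·e = q^{m+1}, ∑_{k=0}^{2m} [(q^{-2m};q)_k (bq^{-m};q)_k (cq^{-m};q)_k (dq^{-m};q)_k (eq^{-m};q)_k / ((q;q)_k (q^{-m+1}/b;q)_k (q^{-m+1}/c;q)_k (q^{-m+1}/d;q)_k (q^{-m+1}/e;q)_k)] q^k = q^{m^2+m} (de)^{-m} (q^{-2m};q)_{2m} (q/bc;q)_m (q/bd;q)_m (q/be;q)_m / [(q;q)_m (q^{-m+1}/b;q)_m (q^{-m+1}/d;q)_m (q^{-m+1}/e;q)_m (c;q)_m]. -/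

import Mathlib

open Finset

noncomputable def qp (q a : ℂ) (n : ℕ) : ℂ := ∏ j ∈ Finset.range n, (1 - a * q ^ j)

noncomputable def qpZ (q a : ℂ) (k : ℤ) : ℂ :=
  if 0 ≤ k then qp q a k.toNat else 1 / qp q (a * q ^ k) (-k).toNat

noncomputable def qpInf (q a : ℂ) : ℂ := ∏' j : ℕ, (1 - a * q ^ j)

theorem qp_zero' (q a : ℂ) : qp q a 0 = 1 := by simp [qp]
theorem qp_succ (q a : ℂ) (n : ℕ) : qp q a (n+1) = qp q a n * (1 - a * q^n) := by
  simp [qp, Finset.prod_range_succ]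
theorem qp_succ' (q a : ℂ) (n : ℕ) : qp q a (n+1) = (1 - a) * qp q (a*q) n := by
  simp only [qp, Finset.prod_range_succ']
  rw [mul_comm]; congr 1
  · simp
  · apply Finset.prod_congr rfl; intros; ring
theorem qp_ne (q a : ℂ) (n : ℕ) (h : ∀ i < n, 1 - a * q^i ≠ 0) : qp q a n ≠ 0 := by
  rw [qp, Finset.prod_ne_zero_iff]; intro i hi; exact h i (Finset.mem_range.1 hi)
theorem qp_ne' {q a : ℂ} {n : ℕ} (h : qp q a n ≠ 0) : ∀ i < n, 1 - a * q^i ≠ 0 := by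
  rw [qp, Finset.prod_ne_zero_iff] at h; intro i hi; exact h i (Finset.mem_range.2 hi)

noncomputable def rho (b c d e N : ℂ) : ℂ :=
  (1-N)*(1-b*e)*(1-c*e)*(1-d*e)/((1-N/b)*(1-N/c)*(1-N/d)*(1-e))
noncomputable def kap (b c d e N : ℂ) : ℂ := (e*N-1)*N/(e*(N-b)*(N-c)*(N-d))

theorem core (b c d e z N : ℂ) (hN : N = b*c*d*e) (hb : b ≠ 0) (hc : c ≠ 0) (hd : d ≠ 0) (he : e ≠ 0)
    (hNb : N - b ≠ 0) (hNc : N - c ≠ 0) (hNd : N - d ≠ 0) (he1 : 1 - e ≠ 0) (hN1 : 1 - N ≠ 0)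
    (h1 : b - z ≠ 0) (h2 : c - z ≠ 0) (h3 : d - z ≠ 0) (h4 : e - z ≠ 0) (h5 : 1 - N*z ≠ 0) :
    (1+z)*z*(1-e*z)*(1-1/N)/((1-z/b)*(1-z/c)*(1-z/d)*(1-N*z)) -
     rho b c d e N * ((1+z)*z*(1-e)*(1-z/N)*(1-1/e)/((1-z/b)*(1-z/c)*(1-z/d)*(1-z/e)*(1-N))) =
    kap b c d e N * ((1-b*z)*(1-c*z)*(1-d*z)*(1-e*z)*(1-z/N)/((1-z/b)*(1-z/c)*(1-z/d)*(1-z/e)*(1-N*z)) - 1) := by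
  have hN0 : N ≠ 0 := by rw [hN]; positivity
  have e1 : 1 - N/b = -(N-b)/b := by field_simp; ring
  have e2 : 1 - N/c = -(N-c)/c := by field_simp; ring
  have e3 : 1 - N/d = -(N-d)/d := by field_simp; ring
  have e4 : 1 - z/b = (b-z)/b := by field_simp
  have e5 : 1 - z/c = (c-z)/c := by field_simp
  have e6 : 1 - z/d = (d-z)/d := by field_simp
  have e7 : 1 - z/e = (e-z)/e := by field_simp
  have key : (1+z)*z*(1-e*z)*(N-1)*(e-z)*(N-b)*(N-c)*(N-d)*e*b*c*d
     - (1-b*e)*(1-c*e)*(1-d*e)*(1+z)*z*(N-z)*(1-e)*(1-N*z)*b*c*d*b*c*d*e =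
     (e*N-1)*N*((1-b*z)*(1-c*z)*(1-d*z)*(1-e*z)*(N-z)*(b*c*d*e) - N*((b-z)*(c-z)*(d-z)*(e-z)*(1-N*z))) := by
    subst hN; ring
  set D := N*e*(N-b)*(N-c)*(N-d)*((b-z)*(c-z)*(d-z)*(e-z)*(1-N*z)) with hD
  have hD0 : D ≠ 0 := by simp only [hD]; positivity
  have t1 : (1+z)*z*(1-e*z)*(1-1/N)/((1-z/b)*(1-z/c)*(1-z/d)*(1-N*z)) =
     ((1+z)*z*(1-e*z)*(N-1)*(e-z)*(N-b)*(N-c)*(N-d)*e*b*c*d)/D := by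
    rw [e4, e5, e6, hD]; field_simp
  have t2 : rho b c d e N * ((1+z)*z*(1-e)*(1-z/N)*(1-1/e)/((1-z/b)*(1-z/c)*(1-z/d)*(1-z/e)*(1-N))) =
     ((1-b*e)*(1-c*e)*(1-d*e)*(1+z)*z*(N-z)*(1-e)*(1-N*z)*b*c*d*b*c*d*e)/D := by
    have e8 : 1 - 1/e = -(1-e)/e := by field_simp; ring
    rw [rho, e1, e2, e3, e4, e5, e6, e7, e8, hD]; field_simp
  have t3 : kap b c d e N * ((1-b*z)*(1-c*z)*(1-d*z)*(1-e*z)*(1-z/N)/((1-z/b)*(1-z/c)*(1-z/d)*(1-z/e)*(1-N*z)) - 1)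
    = ((e*N-1)*N*((1-b*z)*(1-c*z)*(1-d*z)*(1-e*z)*(N-z)*(b*c*d*e) - N*((b-z)*(c-z)*(d-z)*(e-z)*(1-N*z))))/D := by
    rw [kap, e4, e5, e6, e7, hD]; field_simp
  rw [t1, t2, t3, ← key, sub_div]

theorem core0 (b c d e N : ℂ) (hN : N = b*c*d*e) (hb : b ≠ 0) (hc : c ≠ 0) (hd : d ≠ 0) (he : e ≠ 0)
    (hNb : N - b ≠ 0) (hNc : N - c ≠ 0) (hNd : N - d ≠ 0) (he1 : 1 - e ≠ 0) (hN1 : 1 - N ≠ 0) :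
    1 - rho b c d e N = kap b c d e N * ((1-b)*(1-c)*(1-d)/(1-1/e)) := by
  have hN0 : N ≠ 0 := by rw [hN]; positivity
  have e1 : 1 - N/b = -(N-b)/b := by field_simp; ring
  have e2 : 1 - N/c = -(N-c)/c := by field_simp; ring
  have e3 : 1 - N/d = -(N-d)/d := by field_simp; ring
  have e4 : 1 - 1/e = -(1-e)/e := by field_simp; ring
  rw [rho, kap, e1, e2, e3, e4]
  field_simp
  subst hN
  ring

theorem core1 (b c d e N : ℂ) (hN : N = b*c*d*e) (hb : b ≠ 0) (hc : c ≠ 0) (hd : d ≠ 0) (he : e ≠ 0)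
    (hNb : N - b ≠ 0) (hNc : N - c ≠ 0) (hNd : N - d ≠ 0) (h5 : 1 - N*N ≠ 0) :
    kap b c d e N  + (1+N)*N*(1-e*N)*(1-1/N)/((1-N/b)*(1-N/c)*(1-N/d)*(1-N*N)) = 0 := by
  have hN0 : N ≠ 0 := by rw [hN]; positivity
  have e1 : 1 - N/b = -(N-b)/b := by field_simp; ring
  have e2 : 1 - N/c = -(N-c)/c := by field_simp; ring
  have e3 : 1 - N/d = -(N-d)/d := by field_simp; ring
  have h6 : 1 + N ≠ 0 := fun h => h5 (by linear_combination (1-N)*h)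
  have h7 : 1 - N ≠ 0 := fun h => h5 (by linear_combination (1+N)*h)
  have e4 : 1 - N*N = (1+N)*(1-N) := by ring
  rw [kap, e1, e2, e3, e4]
  field_simp
  subst hN
  ring

noncomputable def TT (q b c d e : ℂ) (n k : ℕ) : ℂ :=
  (qp q b k * qp q c k * qp q d k * qp q e k * qp q (q^n)⁻¹ k) /
  (qp q (q/b) k * qp q (q/c) k * qp q (q/d) k * qp q (q/e) k * qp q (q^(n+1)) k) * (q^k * (1+q^k))

noncomputable def WW (q b c d e : ℂ) (n K : ℕ) : ℂ :=
  (qp q b (K+1) * qp q c (K+1) * qp q d (K+1) * qp q (e*q) K * qp q (q^n)⁻¹ K) /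
  (qp q (q/b) K * qp q (q/c) K * qp q (q/d) K * qp q (1/e) (K+1) * qp q (q^(n+2)) K)

theorem TT1 (q b c d e : ℂ) (n K : ℕ) (hq : q ≠ 0) :
    TT q b c d (e*q) (n+1) (K+1) = WW q b c d e n K *
    ((1+q^(K+1))*q^(K+1)*(1-e*q^(K+1))*(1-1/q^(n+1))/
     ((1-q^(K+1)/b)*(1-q^(K+1)/c)*(1-q^(K+1)/d)*(1-q^(n+1)*q^(K+1)))) := by
  have a1 : q / (e*q) = 1/e := by field_simp
  have a2 : (q^(n+1))⁻¹ * q = (q^n)⁻¹ := by field_simp; ring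
  have b1 : q/b*q^K = q^(K+1)/b := by ring
  have b2 : q/c*q^K = q^(K+1)/c := by ring
  have b3 : q/d*q^K = q^(K+1)/d := by ring
  have b4 : q^(n+2)*q^K = q^(n+1)*q^(K+1) := by ring
  have b5 : e*q*q^K = e*q^(K+1) := by ring
  rw [TT, WW, a1, qp_succ' q (q^(n+1))⁻¹, a2, qp_succ q (q/b), qp_succ q (q/c), qp_succ q (q/d), show n+1+1=n+2 from rfl,
    qp_succ q (q^(n+2)), qp_succ q (e*q), b1, b2, b3, b4, b5, div_mul_div_comm, div_mul_eq_mul_div]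
  congr 1 <;> ring

theorem TT0 (q b c d e : ℂ) (n K : ℕ) (hq : q ≠ 0) (he : e ≠ 0) (he1 : 1 - e ≠ 0) :
    TT q b c d e n (K+1) = WW q b c d e n K *
    ((1+q^(K+1))*q^(K+1)*(1-e)*(1-q^(K+1)/q^(n+1))*(1-1/e)/
     ((1-q^(K+1)/b)*(1-q^(K+1)/c)*(1-q^(K+1)/d)*(1-q^(K+1)/e)*(1-q^(n+1)))) := by
  have a1 : 1/e*q = q/e := by ring
  have h1 : 1 - 1/e ≠ 0 := by
    intro h; apply he1; field_simp at h; linear_combination -h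
  have a2 : (q^n)⁻¹ * q^K = q^(K+1)/q^(n+1) := by field_simp; ring
  have a3 : qp q (q/e) (K+1) = qp q (1/e) (K+1) * (1 - q^(K+1)/e) / (1-1/e) := by
    rw [eq_div_iff h1, mul_comm, ← a1, ← qp_succ', qp_succ]; congr 1; ring
  have b1 : q/b*q^K = q^(K+1)/b := by ring
  have b2 : q/c*q^K = q^(K+1)/c := by ring
  have b3 : q/d*q^K = q^(K+1)/d := by ring
  have b4 : q^(n+1)*q = q^(n+2) := by ring
  have aux (X Y Z V P u4 u A : ℂ) (hu : u ≠ 0) : X / (Y * (P*u4/u) * Z) * A = (X*u*A)/(Y*P*u4*Z) := by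
    rw [show Y * (P*u4/u) * Z = (Y*P*u4*Z)/u by ring, div_div_eq_mul_div, div_mul_eq_mul_div]
  rw [TT, WW, a3, aux _ _ _ 1 _ _ _ _ h1, qp_succ q (q^n)⁻¹, a2, qp_succ q (q/b), qp_succ q (q/c), qp_succ q (q/d), 
    qp_succ' q (q^(n+1)), qp_succ' q e, b1, b2, b3, b4, div_mul_div_comm]
  congr 1 <;> ring

theorem WWs (q b c d e : ℂ) (n K : ℕ) (hq : q ≠ 0) :
    WW q b c d e n (K+1) = WW q b c d e n K *
    ((1-b*q^(K+1))*(1-c*q^(K+1))*(1-d*q^(K+1))*(1-e*q^(K+1))*(1-q^(K+1)/q^(n+1))/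
     ((1-q^(K+1)/b)*(1-q^(K+1)/c)*(1-q^(K+1)/d)*(1-q^(K+1)/e)*(1-q^(n+1)*q^(K+1)))) := by
  have a2 : (q^n)⁻¹ * q^K = q^(K+1)/q^(n+1) := by field_simp; ring
  have b1 : q/b*q^K = q^(K+1)/b := by ring
  have b2 : q/c*q^K = q^(K+1)/c := by ring
  have b3 : q/d*q^K = q^(K+1)/d := by ring
  have b4 : q^(n+2)*q^K = q^(n+1)*q^(K+1) := by ring
  have b5 : e*q*q^K = e*q^(K+1) := by ring
  have b6 : 1/e*q^(K+1) = q^(K+1)/e := by ring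
  rw [WW, WW, qp_succ q (q/b), qp_succ q (q/c), qp_succ q (q/d), qp_succ q (q^(n+2)), qp_succ q (e*q),
    qp_succ q (1/e), qp_succ q b (K+1), qp_succ q c (K+1), qp_succ q d (K+1), qp_succ q (q^n)⁻¹,
    a2, b1, b2, b3, b4, b5, b6, div_mul_div_comm]
  congr 1 <;> ring

noncomputable def SS (q b c d e : ℂ) (n : ℕ) : ℂ := 1 + ∑ k ∈ Finset.range n, TT q b c d e n (k+1)

theorem sstep (q b c d e : ℂ) (n : ℕ) (hq : q ≠ 0) (h : b*c*d*e = q^(n+1))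
    (hb : ∀ i, 1 ≤ i → i ≤ n+1 → b - q^i ≠ 0) (hc : ∀ i, 1 ≤ i → i ≤ n+1 → c - q^i ≠ 0)
    (hd : ∀ i, 1 ≤ i → i ≤ n+1 → d - q^i ≠ 0) (he : ∀ i, i ≤ n → e - q^i ≠ 0)
    (h1 : ∀ i, 1 ≤ i → i ≤ 2*n+2 → 1 - q^i ≠ 0) :
    SS q b c d (e*q) (n+1) = rho b c d e (q^(n+1)) * SS q b c d e n := by
  have hN0 : q^(n+1) ≠ 0 := pow_ne_zero _ hq
  have hb0 : b ≠ 0 := by rintro rfl; apply hN0; rw [← h]; ring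
  have hc0 : c ≠ 0 := by rintro rfl; apply hN0; rw [← h]; ring
  have hd0 : d ≠ 0 := by rintro rfl; apply hN0; rw [← h]; ring
  have he0 : e ≠ 0 := by rintro rfl; apply hN0; rw [← h]; ring
  have he1 : 1 - e ≠ 0 := by
    have := he 0 (by omega); intro h; apply this; linear_combination -h
  have hNb : q^(n+1) - b ≠ 0 := fun h => hb (n+1) (by omega) le_rfl (by linear_combination -h)
  have hNc : q^(n+1) - c ≠ 0 := fun h => hc (n+1) (by omega) le_rfl (by linear_combination -h)
  have hNd : q^(n+1) - d ≠ 0 := fun h => hd (n+1) (by omega) le_rfl (by linear_combination -h)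
  have key : ∀ K, K ≤ n → (1 + ∑ k ∈ Finset.range K, TT q b c d (e*q) (n+1) (k+1))
      - rho b c d e (q^(n+1)) * (1 + ∑ k ∈ Finset.range K, TT q b c d e n (k+1)) =
      kap b c d e (q^(n+1)) * WW q b c d e n K := by
    intro K
    induction K with
    | zero =>
      intro _
      have := core0 b c d e (q^(n+1)) h.symm hb0 hc0 hd0 he0 hNb hNc hNd he1 (h1 (n+1) (by omega) (by omega))
      simp [WW, qp]
      simpa using this
    | succ K ih =>
      intro hK
      have ih := ih (by omega)
      have := core b c d e (q^(K+1)) (q^(n+1)) h.symm hb0 hc0 hd0 he0 hNb hNc hNd he1 (h1 (n+1) (by omega) (by omega))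
        (hb _ (by omega) (by omega)) (hc _ (by omega) (by omega)) (hd _ (by omega) (by omega)) (he _ (by omega))
        (by rw [← pow_add]; exact h1 _ (by omega) (by omega))
      rw [Finset.sum_range_succ, Finset.sum_range_succ, TT0 _ _ _ _ _ _ _ hq he0 he1, TT1 _ _ _ _ _ _ _ hq, WWs _ _ _ _ _ _ _ hq]
      linear_combination ih + WW q b c d e n K * this
  have k := key n le_rfl
  have := core1 b c d e (q^(n+1)) h.symm hb0 hc0 hd0 he0 hNb hNc hNd
        (by rw [← pow_add]; exact h1 _ (by omega) (by omega))
  rw [SS, SS, Finset.sum_range_succ, TT1 _ _ _ _ _ _ _ hq]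
  linear_combination k + WW q b c d e n n * this

theorem jackson (q b c d : ℂ) (hq : q ≠ 0) (hb0 : b ≠ 0) (hc0 : c ≠ 0) (hd0 : d ≠ 0) (n : ℕ) 
    (hb : ∀ i, 1 ≤ i → i ≤ n → b - q^i ≠ 0) (hc : ∀ i, 1 ≤ i → i ≤ n → c - q^i ≠ 0)
    (hd : ∀ i, 1 ≤ i → i ≤ n → d - q^i ≠ 0) (he : ∀ i, 1 ≤ i → i ≤ n → b*c*d - q^i ≠ 0)
    (h1 : ∀ i, 1 ≤ i → i ≤ 2*n → 1 - q^i ≠ 0) :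
    SS q b c d (q^(n+1)/(b*c*d)) n = qp q q n * qp q (q/(b*c)) n * qp q (q/(b*d)) n * qp q (q/(c*d)) n /
      (qp q (q/b) n * qp q (q/c) n * qp q (q/d) n * qp q (q/(b*c*d)) n) := by
  induction n with
  | zero => simp [SS, qp]
  | succ n ih =>
    have ih := ih (fun i h h' => hb i h (by omega)) (fun i h h' => hc i h (by omega))
      (fun i h h' => hd i h (by omega)) (fun i h h' => he i h (by omega)) (fun i h h' => h1 i h (by omega))
    have s := sstep q b c d (q^(n+1)/(b*c*d)) n hq (by field_simp) hb hc hd (by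
      intro i hi h
      have := he (n+1-i) (by omega) (by omega)
      apply this
      have e : q^(n+1) = q^(n+1-i)*q^i := by rw [← pow_add]; congr 1; omega
      have : q^i ≠ 0 := pow_ne_zero _ hq
      rw [e] at h
      field_simp at h
      have h : q ^ i * (q ^ (n + 1 - i) - b * c * d) = 0 := by rw [h]; ring
      rcases mul_eq_zero.1 h with h | h
      · contradiction
      · linear_combination -h) h1
    rw [show q^(n+1+1)/(b*c*d) = q^(n+1)/(b*c*d)*q by ring, s, ih, rho]
    simp only [qp_succ]
    have x1 : q*q^n = q^(n+1) := by ring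
    have x2 (y : ℂ) : q/y*q^n = q^(n+1)/y := by ring
    simp only [x1, x2]
    have y1 : b*(q^(n+1)/(b*c*d)) = q^(n+1)/(c*d) := by field_simp
    have y2 : c*(q^(n+1)/(b*c*d)) = q^(n+1)/(b*d) := by field_simp
    have y3 : d*(q^(n+1)/(b*c*d)) = q^(n+1)/(b*c) := by field_simp
    rw [y1, y2, y3, div_mul_div_comm]
    congr 1 <;> ring

theorem qp_add (q a : ℂ) (m n : ℕ) : qp q a (m+n) = qp q a m * qp q (a*q^m) n := by
  simp only [qp, Finset.prod_range_add]
  congr 1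
  apply Finset.prod_congr rfl; intros; ring

noncomputable def sg (q : ℂ) (j : ℕ) : ℂ := ∏ i ∈ Finset.range j, (-(q^(i+1))⁻¹)

theorem sg_ne (q : ℂ) (hq : q ≠ 0) (j : ℕ) : sg q j ≠ 0 := by
  rw [sg, Finset.prod_ne_zero_iff]; intro i _
  exact neg_ne_zero.2 (inv_ne_zero (pow_ne_zero _ hq))

theorem sg_sq (q : ℂ) (hq : q ≠ 0) (j : ℕ) : sg q j ^ 2 * q^(j^2+j) = 1 := by
  induction j with
  | zero => simp [sg]
  | succ j ih =>
    have : sg q (j+1) = sg q j * (-(q^(j+1))⁻¹) := by simp [sg, Finset.prod_range_succ]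
    rw [this, ← ih, show (j+1)^2+(j+1) = (j^2+j) + (j+1)*2 by ring, pow_add q (j^2+j) ((j+1)*2), pow_mul q (j+1) 2]
    have : q^(j+1) ≠ 0 := pow_ne_zero _ hq
    generalize q^(j+1) = y at *
    field_simp

theorem qp_rev (q x : ℂ) (hq : q ≠ 0) (hx : x ≠ 0) (j : ℕ) :
    qp q (x / q^j) j = qp q (q/x) j * x^j * sg q j := by
  induction j with
  | zero => simp [sg, qp]
  | succ j ih =>
    have h1 : sg q (j+1) = sg q j * (-(q^(j+1))⁻¹) := by simp [sg, Finset.prod_range_succ]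
    have h2 : x / q^(j+1) * q = x / q^j := by field_simp; try ring
    have h3 : 1 - x/q^(j+1) = (1 - q/x*q^j)*x*(-(q^(j+1))⁻¹) := by field_simp; ring
    rw [qp_succ', h2, ih, h1, qp_succ, h3]; ring

noncomputable def rr (q : ℂ) (m : ℕ) (x : ℂ) (k : ℕ) : ℂ := qp q (x/q^m) k / qp q (q/q^m/x) k

theorem rr_up (q x : ℂ) (m j : ℕ) (hq : q ≠ 0) :
    rr q m x (m+j) = rr q m x m * (qp q x j / qp q (q/x) j) := by
  have hM : q^m ≠ 0 := pow_ne_zero _ hq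
  rw [rr, rr, qp_add, qp_add, div_mul_div_comm, show x/q^m*q^m = x by field_simp,
    show q/q^m/x*q^m = q/x by field_simp]

theorem nz (q x : ℂ) (m : ℕ) (hq : q ≠ 0) (hx : x ≠ 0) (h : qp q (q/q^m/x) (2*m) ≠ 0) :
    qp q (q/q^m/x) m ≠ 0 ∧ qp q (q/x) m ≠ 0 ∧ qp q x m ≠ 0 := by
  have hM : q^m ≠ 0 := pow_ne_zero _ hq
  rw [two_mul, qp_add, show q/q^m/x*q^m = q/x by field_simp] at h
  have h1 := left_ne_zero_of_mul h
  refine ⟨h1, right_ne_zero_of_mul h, ?_⟩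
  rw [show q/q^m/x = q/x/q^m by ring, qp_rev q (q/x) hq (div_ne_zero hq hx), show q/(q/x) = x by field_simp] at h1
  exact left_ne_zero_of_mul (left_ne_zero_of_mul h1)

theorem qp_le {q x : ℂ} {m j : ℕ} (hj : j ≤ m) (h : qp q x m ≠ 0) : qp q x j ≠ 0 :=
  qp_ne _ _ _ fun i hi => qp_ne' h i (by omega)

theorem rr_down (q x : ℂ) (m j : ℕ) (hj : j ≤ m) (hq : q ≠ 0) (hx : x ≠ 0) (h : qp q (q/q^m/x) (2*m) ≠ 0) :
    rr q m x (m-j) = rr q m x m * (qp q x j / qp q (q/x) j * (q/x^2)^j) := by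
  obtain ⟨h1, h2, h3⟩ := nz q x m hq hx h
  obtain ⟨i, rfl⟩ : ∃ i, m = i + j := ⟨m-j, by omega⟩
  have e1 : x/q^(i+j)*q^i = x/q^j := by rw [pow_add]; field_simp
  have e2 : q/q^(i+j)/x*q^i = q/x/q^j := by rw [pow_add]; field_simp
  have g1 := qp_le hj h2
  have g2 := qp_le hj h3
  have g3 := qp_le (show i ≤ i + j by omega) h1
  have g4 := sg_ne q hq j
  rw [Nat.add_sub_cancel, rr, rr, qp_add, qp_add, e1, e2, qp_rev q x hq hx, qp_rev q (q/x) hq (div_ne_zero hq hx),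
    show q/(q/x) = x by field_simp]
  have : (q/x)^j = x^j * (q/x^2)^j := by rw [← mul_pow]; congr 1; field_simp
  have g5 : (q/x^2)^j ≠ 0 := pow_ne_zero _ (by positivity)
  rw [this]
  generalize (q/x^2)^j = y at *
  generalize qp q (q/x) j = y1 at *
  generalize qp q x j = y2 at *
  generalize qp q (q/q^(i+j)/x) i = y3 at *
  field_simp

theorem factor_ne {q x : ℂ} {m : ℕ} (hx : x ≠ 0) (h : qp q (q/x) m ≠ 0) : ∀ i, 1 ≤ i → i ≤ m → x - q^i ≠ 0 := by
  intro i h1 h2 h3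
  have := qp_ne' h (i-1) (by omega)
  apply this
  obtain ⟨k, rfl⟩ : ∃ k, i = k+1 := ⟨i-1, by omega⟩
  rw [Nat.add_sub_cancel]
  field_simp
  linear_combination h3

theorem main_sum (q b c d e : ℂ) (m : ℕ) (hq : q ≠ 0) (hb : b ≠ 0) (hc : c ≠ 0) (hd : d ≠ 0) (he : e ≠ 0)
    (hbcde : b * c * d * e = q ^ (m + 1))
    (h1 : qp q (q/q^m/(q^m)⁻¹) (2 * m) ≠ 0)
    (h2 : qp q (q/q^m / b) (2 * m) ≠ 0) (h3 : qp q (q/q^m / c) (2 * m) ≠ 0)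
    (h4 : qp q (q/q^m / d) (2 * m) ≠ 0) (h5 : qp q (q/q^m / e) (2 * m) ≠ 0) :
    ∑ k ∈ Finset.range (2*m+1), rr q m (q^m)⁻¹ k * rr q m b k * rr q m c k * rr q m d k * rr q m e k * q^k =
    rr q m (q^m)⁻¹ m * rr q m b m * rr q m c m * rr q m d m * rr q m e m * q^m * SS q b c d e m := by
  have hM : (q^m)⁻¹ ≠ 0 := inv_ne_zero (pow_ne_zero _ hq)
  have tt : ∀ j, TT q b c d e m j = (qp q (q^m)⁻¹ j / qp q (q/(q^m)⁻¹) j) * (qp q b j / qp q (q/b) j) *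
     (qp q c j / qp q (q/c) j) * (qp q d j / qp q (q/d) j) * (qp q e j / qp q (q/e) j) * (q^j + q^(2*j)) := by
    intro j
    rw [TT, show q/(q^m)⁻¹ = q^(m+1) by field_simp; try ring]
    simp only [div_mul_div_comm]
    congr 1
    · congr 1 <;> ring
    · ring
  rw [show 2*m+1 = m + (m+1) by ring, Finset.sum_range_add, ← Finset.sum_range_reflect, Finset.sum_range_succ', SS, ← add_assoc,
    ← Finset.sum_add_distrib, mul_add, Finset.mul_sum, mul_one, add_zero, add_comm]
  congr 1
  apply Finset.sum_congr rfl
  intro j hj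
  have hj := Finset.mem_range.1 hj
  rw [show m - 1 - j = m - (j+1) by omega, tt]
  simp only [rr_up _ _ _ _ hq]
  have hle : j + 1 ≤ m := hj
  rw [rr_down q _ m _ hle hq hM h1, rr_down q _ m _ hle hq hb h2, rr_down q _ m _ hle hq hc h3,
    rr_down q _ m _ hle hq hd h4, rr_down q _ m _ hle hq he h5]
  have key : (q/(q^m)⁻¹^2)^(j+1) * (q/b^2)^(j+1) * (q/c^2)^(j+1) * (q/d^2)^(j+1) * (q/e^2)^(j+1) * q^(m-(j+1))
     = q^m * q^(2*(j+1)) := by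
    simp only [← mul_pow]
    have : q/(q^m)⁻¹^2*(q/b^2)*(q/c^2)*(q/d^2)*(q/e^2) = q^3 := by
      have : q/(q^m)⁻¹^2*(q/b^2)*(q/c^2)*(q/d^2)*(q/e^2) = q^5*(q^m)^2/(b*c*d*e)^2 := by field_simp
      rw [this, hbcde]; field_simp; try ring
    rw [this, ← pow_mul, ← pow_add, ← pow_add]; congr 1; omega
  rw [pow_add q m (j+1)]
  linear_combination (rr q m (q^m)⁻¹ m * rr q m b m * rr q m c m * rr q m d m * rr q m e m) * (qp q (q^m)⁻¹ (j+1) / qp q (q/(q^m)⁻¹) (j+1)) * (qp q b (j+1) / qp q (q/b) (j+1)) *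
     (qp q c (j+1) / qp q (q/c) (j+1)) * (qp q d (j+1) / qp q (q/d) (j+1)) * (qp q e (j+1) / qp q (q/e) (j+1)) * key


theorem stmt11 (q b c d e : ℂ) (m : ℕ) (hq : q ≠ 0)
    (hbcde : b * c * d * e = q ^ (m + 1))
    (h1 : qp q q (2 * m) ≠ 0)
    (h2 : qp q (q ^ (1 - (m : ℤ)) / b) (2 * m) ≠ 0) (h3 : qp q (q ^ (1 - (m : ℤ)) / c) (2 * m) ≠ 0)
    (h4 : qp q (q ^ (1 - (m : ℤ)) / d) (2 * m) ≠ 0) (h5 : qp q (q ^ (1 - (m : ℤ)) / e) (2 * m) ≠ 0)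
    (h6 : qp q c m ≠ 0) :
    (∑ k ∈ Finset.range (2 * m + 1),
        (qp q (q ^ (-(2 * m : ℤ))) k * qp q (b * q ^ (-(m : ℤ))) k * qp q (c * q ^ (-(m : ℤ))) k *
            qp q (d * q ^ (-(m : ℤ))) k * qp q (e * q ^ (-(m : ℤ))) k) /
          (qp q q k * qp q (q ^ (1 - (m : ℤ)) / b) k * qp q (q ^ (1 - (m : ℤ)) / c) k *
            qp q (q ^ (1 - (m : ℤ)) / d) k * qp q (q ^ (1 - (m : ℤ)) / e) k) * q ^ k) =
      q ^ (m ^ 2 + m) * (d * e) ^ (-(m : ℤ)) *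
        (qp q (q ^ (-(2 * m : ℤ))) (2 * m) * qp q (q / (b * c)) m * qp q (q / (b * d)) m *
          qp q (q / (b * e)) m) /
        (qp q q m * qp q (q ^ (1 - (m : ℤ)) / b) m * qp q (q ^ (1 - (m : ℤ)) / d) m *
          qp q (q ^ (1 - (m : ℤ)) / e) m * qp q c m) := by
  have hN0 : q^(m+1) ≠ 0 := pow_ne_zero _ hq
  have hM : q^m ≠ 0 := pow_ne_zero _ hq
  have hb : b ≠ 0 := by rintro rfl; apply hN0; rw [← hbcde]; ring
  have hc : c ≠ 0 := by rintro rfl; apply hN0; rw [← hbcde]; ring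
  have hd : d ≠ 0 := by rintro rfl; apply hN0; rw [← hbcde]; ring
  have he : e ≠ 0 := by rintro rfl; apply hN0; rw [← hbcde]; ring
  have z1 : q ^ (1 - (m:ℤ)) = q/q^m := by rw [zpow_sub₀ hq]; simp
  have z2 : q ^ (-(m:ℤ)) = (q^m)⁻¹ := by simp
  have z3 : q ^ (-(2*m:ℤ)) = (q^m)⁻¹/q^m := by
    rw [zpow_neg, two_mul, zpow_add₀ hq]; simp only [zpow_natCast]; field_simp
  have z4 : (d*e) ^ (-(m:ℤ)) = ((d*e)^m)⁻¹ := by simp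
  have z5 : q/q^m/(q^m)⁻¹ = q := by field_simp
  simp only [z1, z2, z3, z4] at *
  clear z1 z2 z3 z4
  have ms := main_sum q b c d e m hq hb hc hd he hbcde (by rwa [z5]) h2 h3 h4 h5
  have hn1 := nz q _ m hq (inv_ne_zero hM) (by rw [z5]; exact h1)
  have hn2 := nz q b m hq hb h2
  have hn3 := nz q c m hq hc h3
  have hn4 := nz q d m hq hd h4
  have hn5 := nz q e m hq he h5
  have ee : e = q^(m+1)/(b*c*d) := by rw [← hbcde]; field_simp
  have e5 : q/(b*c*d) = e/q^m := by rw [ee]; field_simp; try ring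
  have hE : qp q (e/q^m) m ≠ 0 := by
    rw [qp_rev q e hq he]
    exact mul_ne_zero (mul_ne_zero hn5.2.1 (pow_ne_zero _ he)) (sg_ne q hq m)
  have jk := jackson q b c d hq hb hc hd m (factor_ne hb hn2.2.1) (factor_ne hc hn3.2.1) (factor_ne hd hn4.2.1)
    (factor_ne (mul_ne_zero (mul_ne_zero hb hc) hd) (by rw [e5]; exact hE))
    (factor_ne one_ne_zero (by rw [div_one]; exact h1))
  rw [← ee, e5] at jk
  rw [jk] at ms
  have lhs : ∀ k, rr q m (q^m)⁻¹ k * rr q m b k * rr q m c k * rr q m d k * rr q m e k * q^k =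
    (qp q ((q^m)⁻¹/q^m) k * qp q (b * (q^m)⁻¹) k * qp q (c * (q^m)⁻¹) k *
            qp q (d * (q^m)⁻¹) k * qp q (e * (q^m)⁻¹) k) /
          (qp q q k * qp q (q/q^m / b) k * qp q (q/q^m / c) k *
            qp q (q/q^m / d) k * qp q (q/q^m / e) k) * q ^ k := by
    intro k
    simp only [rr, z5, div_mul_div_comm, ← div_eq_mul_inv]
  simp only [← lhs]
  rw [ms]
  have r1 : qp q ((q^m)⁻¹/q^m) (2*m) = qp q ((q^m)⁻¹/q^m) m * (qp q q m * sg q m) := by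
    have := qp_rev q 1 hq one_ne_zero m
    rw [two_mul, qp_add, show (q^m)⁻¹/q^m*q^m = 1/q^m by field_simp, this]; simp
  have r2 : qp q (q/(c*d)) m = qp q (q/(b*e)) m * (b*e)^m * sg q m := by
    rw [← qp_rev q (b*e) hq (mul_ne_zero hb he)]; congr 1
    have : b*e = q^(m+1)/(c*d) := by rw [← hbcde]; field_simp
    rw [this]; field_simp; try ring
  have r3 : qp q (q/q^m/c) m = qp q c m * (q/c)^m * sg q m := by
    rw [show q/q^m/c = q/c/q^m by ring, qp_rev q (q/c) hq (div_ne_zero hq hc), show q/(q/c) = c by field_simp]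
  have hs := sg_sq q hq m
  have hs0 := sg_ne q hq m
  have hp : q^(m^2+m) = b^m*c^m*d^m*e^m := by
    rw [← mul_pow, ← mul_pow, ← mul_pow, hbcde, ← pow_mul]; congr 1; ring
  simp only [rr, z5]
  rw [r1, r2, r3, qp_rev q b hq hb, qp_rev q c hq hc, qp_rev q d hq hd, hp]
  rw [hp] at hs
  have n1 : qp q q m ≠ 0 := qp_le (by omega) h1
  have n2 := hn2.1
  have n2' := hn2.2.1
  have n3' := hn3.2.1
  have n4 := hn4.1
  have n4' := hn4.2.1
  have n5 := hn5.1
  simp only [mul_pow, div_pow]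
  have p1 := pow_ne_zero m hb
  have p2 := pow_ne_zero m hc
  have p3 := pow_ne_zero m hd
  have p4 := pow_ne_zero m he
  clear * - n1 n2 n2' n3' n4 n4' n5 p1 p2 p3 p4 hs hs0 h6 hE hM
  generalize qp q (q/q^m/b) m = x1 at *
  generalize qp q (q/q^m/d) m = x2 at *
  generalize qp q (q/q^m/e) m = x3 at *
  generalize qp q (e/q^m) m = x4 at *
  generalize qp q ((q^m)⁻¹/q^m) m = x5 at *
  generalize qp q (q/b) m = x6 at *
  generalize qp q (q/c) m = x7 at *
  generalize qp q (q/d) m = x8 at *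
  generalize qp q (q/(b*c)) m = x9 at *
  generalize qp q (q/(b*d)) m = x10 at *
  generalize qp q (q/(b*e)) m = x11 at *
  generalize qp q q m = x12 at *
  generalize qp q c m = x13 at *
  generalize sg q m = s at *
  generalize q^m = M at *
  generalize b^m = B at *
  generalize c^m = C at *
  generalize d^m = D at *
  generalize e^m = E at *
  have hs' : B = 1/(s^2*C*D*E) := by
    rw [eq_div_iff (by positivity)]; linear_combination hs
  subst hs'
  field_simp
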